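/- Let F = ℚ(x, y) be the rational function field in two variables. Then S^⧢[ I^+_{4,1}(x, y) + I^+_{4,1}(x^{−1}, y) ] = S^⧢[ −2·Li_5(y/x) − 2·Li_5(xy) − Li_5(x) − Li_5(y) ] in V_F^{⊗5}. -/

import Mathlib

open scoped TensorProduct
open PiTensorProduct

attribute [local instance] Classical.propDecidable

set_option maxHeartbeats 1000000
set_option synthInstance.maxHeartbeats 400000

noncomputable section

namespace GrassPoly

variable (F : Type) [Field F]

/-- `V_F = F^× ⊗_ℤ ℚ` as a `ℚ`-vector space. -/
abbrev VF : Type := ℚ ⊗[ℤ] (Additive Fˣ)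

variable {F}

/-- The class `[a]` of a nonzero field element in `V_F` (defined to be `0` for `a = 0`). -/
def cls (a : F) : VF F :=
  if h : a = 0 then 0 else (1 : ℚ) ⊗ₜ[ℤ] (Additive.ofMul (Units.mk0 a h))

variable (F) in
/-- Tensor powers of V_F over ℚ. -/
abbrev TP (n : ℕ) : Type := ⨂[ℚ]^n (VF F)

instance instTPAddCommGroup (n : ℕ) : AddCommGroup (TP F n) :=
  Module.addCommMonoidToAddCommGroup ℚ

/-- Appending one extra tensor factor on the right. -/
def snoc {n : ℕ} : TP F n →ₗ[ℚ] VF F →ₗ[ℚ] TP F (n + 1) :=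
  PiTensorProduct.lift
    ((PiTensorProduct.tprod ℚ (s := fun _ : Fin (n + 1) => VF F)).curryRight)

/-- The factor `t_i` appearing in the recursive definition of the symbol,
as a function of `(a_{i-1}, a_i, a_{i+1})`. -/
def tCoef (p a q : F) : VF F :=
  if p = a then (if a = q then 0 else cls (q - a))
  else if a = q then - cls (p - a)
  else cls ((q - a) / (p - a))

/-- The symbol `S I(a₀; a₁, …, a_m; a_{m+1})`, with the middle entries given as a list
(of length `n`). -/
def SIaux : (n : ℕ) → (a0 : F) → (as : List F) → (b : F) → as.length = n → TP F n
  | 0, _, _, _, _ => tprod ℚ (fun i : Fin 0 => i.elim0)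
  | n + 1, a0, as, b, h =>
      ∑ i : Fin (n + 1),
        snoc (SIaux n a0 (as.eraseIdx i.val) b
            (by
              have hi' := i.isLt
              have hi : i.val < as.length := by omega
              have h2 := List.length_eraseIdx_of_lt hi
              omega))
          (tCoef ((a0 :: as).getD i.val 0) (as.getD i.val 0) ((as ++ [b]).getD (i.val + 1) 0))

/-- Cyclic rotation `b₁ ⊗ … ⊗ b_N ↦ b₂ ⊗ … ⊗ b_N ⊗ b₁` on tensor powers. -/
def rotN (n : ℕ) : TP F n ≃ₗ[ℚ] TP F n :=
  PiTensorProduct.reindex ℚ (fun _ : Fin n => VF F) (finRotate n).symm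

/-- Splitting off the last tensor factor. -/
def splitLast (n : ℕ) : TP F (n + 1) ≃ₗ[ℚ] (TP F n) ⊗[ℚ] (VF F) :=
  ((PiTensorProduct.reindex ℚ (fun _ : Fin (n + 1) => VF F)
      (finSumFinEquiv (m := n) (n := 1)).symm).trans
    (PiTensorProduct.tmulEquiv ℚ (VF F)).symm).trans
    (TensorProduct.congr (LinearEquiv.refl ℚ _)
      (PiTensorProduct.subsingletonEquiv (0 : Fin 1)))

/-- The projector `Π̃_N` annihilating symbols of products. -/
def Pit : (n : ℕ) → TP F n →ₗ[ℚ] TP F n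
  | 0 => LinearMap.id
  | 1 => LinearMap.id
  | (n + 2) =>
      ((splitLast (n + 1)).symm.toLinearMap
        ∘ₗ TensorProduct.map (Pit (n + 1)) LinearMap.id
        ∘ₗ (splitLast (n + 1)).toLinearMap)
      ∘ₗ ((LinearMap.id : TP F (n + 2) →ₗ[ℚ] TP F (n + 2)) - (rotN (F := F) (n + 2)).toLinearMap)

/-- The map on `V_F` induced by a field automorphism. -/
def vmap (φ : F ≃+* F) : VF F →ₗ[ℚ] VF F :=
  TensorProduct.AlgebraTensorModule.map (LinearMap.id : ℚ →ₗ[ℚ] ℚ)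
    (AddMonoidHom.toIntLinearMap
      { toFun := fun a => Additive.ofMul ((Units.map (φ : F →* F)) a.toMul)
        map_zero' := by simp
        map_add' := by intro a b; simp [_root_.map_mul] })

/-- The induced map on tensor powers. -/
def tpMap {n : ℕ} (φ : F ≃+* F) : TP F n →ₗ[ℚ] TP F n :=
  PiTensorProduct.map (fun _ => vmap φ)


/-! ### Symbols of (multiple) polylogarithms -/

/-- Symbol of `Li₂`. -/
def SLi2 (x : F) : TP F 2 := - SIaux 2 0 [x⁻¹, 0] 1 rfl

/-- Symbol of `Li₃`. -/
def SLi3 (x : F) : TP F 3 := - SIaux 3 0 [x⁻¹, 0, 0] 1 rfl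

/-- Symbol of `Li₄`. -/
def SLi4 (x : F) : TP F 4 := - SIaux 4 0 [x⁻¹, 0, 0, 0] 1 rfl

/-- Symbol of `Li₅`. -/
def SLi5 (x : F) : TP F 5 := - SIaux 5 0 [x⁻¹, 0, 0, 0, 0] 1 rfl

/-- Symbol of `I_{3,1}(x,y) = I(0; x,0,0,y; 1)`. -/
def SI31 (x y : F) : TP F 4 := SIaux 4 0 [x, 0, 0, y] 1 rfl

/-- Symbol of `I_{4,1}(x,y) = I(0; x,0,0,0,y; 1)`. -/
def SI41 (x y : F) : TP F 5 := SIaux 5 0 [x, 0, 0, 0, y] 1 rfl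

/-- Symbol of `I⁺_{4,1}(x,y) = ½ (I_{4,1}(x,y) + I_{4,1}(x,y⁻¹))`. -/
def I41p (x y : F) : TP F 5 := (2 : ℚ)⁻¹ • (SI41 x y + SI41 x y⁻¹)

/-- The anharmonic orbit of `x`, together with the signs of the
corresponding permutations in `S₃`. -/
def anhList (x : F) : List (ℚ × F) :=
  [(1, x), (1, (1 - x)⁻¹), (1, 1 - x⁻¹), (-1, x⁻¹), (-1, 1 - x), (-1, x / (x - 1))]

/-- Symbol of `Ĩ_{3,1}(x,y) = (1/36) Σ_{σ,π ∈ S₃} sgn(σ) sgn(π) I_{3,1}(x^σ, y^π)`. -/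
def tI31 (x y : F) : TP F 4 :=
  (36 : ℚ)⁻¹ •
    ((anhList x).map (fun p =>
      ((anhList y).map (fun q => (p.1 * q.1) • SI31 p.2 q.2)).sum)).sum

/-- Symbol of `Ĩ⁺_{4,1}(x,y) = (1/6) Σ_{σ ∈ S₃} sgn(σ) I⁺_{4,1}(x^σ, y)`. -/
def tI41p (x y : F) : TP F 5 :=
  (6 : ℚ)⁻¹ • ((anhList x).map (fun p => p.1 • I41p p.2 y)).sum

/-- Symbol of `V(z; x, y) = Ĩ_{3,1}(z, [x]+[y]+[(1-x)/(1-xy)]+[1-xy]+[(1-y)/(1-xy)])`. -/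
def Vc (z x y : F) : TP F 4 :=
  tI31 z x + tI31 z y + tI31 z ((1 - x) / (1 - x * y)) + tI31 z (1 - x * y)
    + tI31 z ((1 - y) / (1 - x * y))

/-- `Sym₃₆(a,b) := I_{3,1}(a,b) - Ĩ_{3,1}(a,b)` (on the level of symbols). -/
def S36 (a b : F) : TP F 4 := SI31 a b - tI31 a b

/-! ### Generic vectors -/

variable (N m : ℕ)

/-- Polynomial ring on the entries of `N` generic vectors in `m`-space. -/
abbrev Pol : Type := MvPolynomial (Fin N × Fin m) ℚ

/-- The field of rational functions in the entries of `N` generic vectors in `m`-space. -/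
abbrev FF : Type := FractionRing (Pol N m)

/-- The `j`-th coordinate of the `i`-th generic vector. -/
def gen (i : Fin N) (j : Fin m) : FF N m :=
  algebraMap (Pol N m) (FF N m) (MvPolynomial.X (i, j))

/-- `⟨i₁ … i_m⟩`: the determinant of the matrix whose columns are
the generic vectors selected by `cols`. -/
def dets (cols : Fin m → Fin N) : FF N m :=
  (Matrix.of fun r c => gen N m (cols c) r).det

/-- The field automorphism of `FF N m` induced by a permutation of the `N` vectors. -/
def permAut (σ : Equiv.Perm (Fin N)) : FF N m ≃+* FF N m :=
  IsFractionRing.ringEquivOfRingEquiv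
    ((MvPolynomial.renameEquiv ℚ (σ.prodCongr (Equiv.refl (Fin m)))).toRingEquiv)

variable {N m}

/-- Skew-symmetrization over all permutations of the `N` generic vectors. -/
def Alt {n : ℕ} (x : TP (FF N m) n) : TP (FF N m) n :=
  ∑ σ : Equiv.Perm (Fin N), (((Equiv.Perm.sign σ : ℤˣ) : ℤ) : ℚ) • tpMap (permAut N m σ) x

end GrassPoly

end

namespace GrassPoly

noncomputable section TwoVar

/-- The rational function field `ℚ(x, y)`. -/
abbrev K2 : Type := FractionRing (MvPolynomial (Fin 2) ℚ)

/-- The variable `x`. -/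
def xx : K2 := algebraMap (MvPolynomial (Fin 2) ℚ) K2 (MvPolynomial.X 0)

/-- The variable `y`. -/
def yy : K2 := algebraMap (MvPolynomial (Fin 2) ℚ) K2 (MvPolynomial.X 1)

end TwoVar

end GrassPoly

open GrassPoly

namespace GrassPoly

/-! ### The class map and tensors in a fixed family of letters -/

section Classes

variable {F : Type} [Field F]

theorem cls_zero : cls (0 : F) = 0 := by simp [cls]

theorem cls_mul {a b : F} (ha : a ≠ 0) (hb : b ≠ 0) : cls (a * b) = cls a + cls b := by
  have h : Units.mk0 (a * b) (mul_ne_zero ha hb) = Units.mk0 a ha * Units.mk0 b hb := by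
    ext; rfl
  simp only [cls, ha, hb, mul_ne_zero ha hb, dite_false, h, ofMul_mul, TensorProduct.tmul_add]

theorem cls_one : cls (1 : F) = 0 := by
  have h := cls_mul (one_ne_zero (α := F)) (one_ne_zero (α := F))
  rw [mul_one] at h
  exact left_eq_add.mp h

theorem cls_neg (a : F) : cls (-a) = cls a := by
  by_cases ha : a = 0
  · simp [ha]
  have hneg : (-1 : F) ≠ 0 := neg_ne_zero.mpr one_ne_zero
  have h := cls_mul hneg hneg
  rw [neg_one_mul, neg_neg, cls_one, ← two_smul ℚ] at h
  have h' : cls (-1 : F) = 0 := (smul_eq_zero.mp h.symm).resolve_left two_ne_zero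
  rw [← neg_one_mul, cls_mul hneg ha, h', zero_add]

theorem cls_sub_comm (a b : F) : cls (a - b) = cls (b - a) := by
  rw [← neg_sub, cls_neg]

theorem cls_inv (a : F) : cls a⁻¹ = -cls a := by
  by_cases ha : a = 0
  · simp [ha, cls_zero]
  have h := cls_mul ha (inv_ne_zero ha)
  rw [mul_inv_cancel₀ ha, cls_one] at h
  exact (neg_eq_of_add_eq_zero_right h.symm).symm

theorem cls_div {a b : F} (ha : a ≠ 0) (hb : b ≠ 0) : cls (a / b) = cls a - cls b := by
  rw [div_eq_mul_inv, cls_mul ha (inv_ne_zero hb), cls_inv, sub_eq_add_neg]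

theorem tCoef_eq (p a q : F) : tCoef p a q = cls (q - a) - cls (p - a) := by
  unfold tCoef
  split_ifs with h₁ h₂ h₂
  · simp [← h₁, ← h₂, cls_zero]
  · simp [← h₁, cls_zero]
  · simp [← h₂, cls_zero]
  · exact cls_div (sub_ne_zero.mpr (Ne.symm h₂)) (sub_ne_zero.mpr h₁)

theorem snoc_tprod {n : ℕ} (f : Fin n → VF F) (b : VF F) :
    snoc (tprod ℚ f) b = tprod ℚ (Fin.snoc f b : Fin (n + 1) → VF F) := by
  simp [snoc]

theorem splitLast_tprod {n : ℕ} (f : Fin (n + 1) → VF F) :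
    splitLast n (tprod ℚ f) = tprod ℚ (Fin.init f) ⊗ₜ[ℚ] f (Fin.last n) := by
  simp only [splitLast, LinearEquiv.trans_apply, reindex_tprod, tmulEquiv_symm_apply,
    TensorProduct.congr_tmul, LinearEquiv.refl_apply, subsingletonEquiv_apply_tprod]
  rfl

theorem splitLast_symm_tmul {n : ℕ} (t : TP F n) (b : VF F) :
    (splitLast n).symm (t ⊗ₜ[ℚ] b) = snoc t b := by
  induction t using PiTensorProduct.induction_on with
  | smul_tprod r f =>
    rw [map_smul, LinearMap.smul_apply, ← TensorProduct.smul_tmul', map_smul, snoc_tprod]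
    congr 1
    rw [LinearEquiv.symm_apply_eq, splitLast_tprod, Fin.init_snoc, Fin.snoc_last]
  | add s t hs ht => rw [TensorProduct.add_tmul, map_add, map_add, LinearMap.add_apply, hs, ht]

theorem Pit_tprod {n : ℕ} (f : Fin (n + 2) → VF F) :
    Pit (n + 2) (tprod ℚ f) =
      snoc (Pit (n + 1) (tprod ℚ (Fin.init f))) (f (Fin.last _))
        - snoc (Pit (n + 1) (tprod ℚ (Fin.tail f))) (f 0) := by
  have key : ∀ g : Fin (n + 2) → VF F,
      (splitLast (n + 1)).symm (TensorProduct.map (Pit (n + 1)) LinearMap.id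
        (splitLast (n + 1) (tprod ℚ g))) =
      snoc (Pit (n + 1) (tprod ℚ (Fin.init g))) (g (Fin.last _)) := by
    intro g
    rw [splitLast_tprod, TensorProduct.map_tmul, LinearMap.id_apply, splitLast_symm_tmul]
  have hrot : rotN (n + 2) (tprod ℚ f) = tprod ℚ (fun i => f (finRotate (n + 2) i)) := by
    rw [rotN, reindex_tprod, Equiv.symm_symm]
  have hinit : Fin.init (fun i => f (finRotate (n + 2) i)) = Fin.tail f := by
    funext i
    simp only [Fin.init, Fin.tail, finRotate_apply, Fin.coeSucc_eq_succ]
  simp only [Pit, LinearMap.comp_apply, LinearMap.sub_apply, LinearMap.id_apply,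
    LinearEquiv.coe_coe, map_sub, hrot, key, hinit, finRotate_last]

end Classes

section Words

variable {F : Type} [Field F] (L : Fin 6 → VF F)

/-- The pure tensor of length `n` in the letters `L` spelled by a word, padded by the letter `0`. -/
noncomputable def wordTensor (n : ℕ) (w : List (Fin 6)) : TP F n :=
  tprod ℚ fun i : Fin n => L (w.getD i 0)

/-- The tensor of length `n` represented by an integral combination of words. -/
noncomputable def evalWords (n : ℕ) (E : List (ℤ × List (Fin 6))) : TP F n :=
  (E.map fun p => (p.1 : ℚ) • wordTensor L n p.2).sum

/-- An integral linear combination of the letters `L`. -/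
noncomputable def evalLetters (v : Fin 6 → ℤ) : VF F := ∑ l, (v l : ℚ) • L l

/-- Scaling of a combination of words. -/
def scaleWords (c : ℤ) (E : List (ℤ × List (Fin 6))) : List (ℤ × List (Fin 6)) :=
  E.map fun p => (c * p.1, p.2)

/-- Appending a linear combination of letters to a combination of words. -/
def snocWords (E : List (ℤ × List (Fin 6))) (v : Fin 6 → ℤ) : List (ℤ × List (Fin 6)) :=
  (List.finRange 6).flatMap fun l =>
    bif (v l).natAbs.beq 0 then [] else E.map fun p => (v l * p.1, p.2 ++ [l])

/-- The symbol of an iterated integral as a combination of words, for points labelled by `Fin 4`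
whose differences have classes with coordinates `d`. -/
def symbolWords (d : Fin 4 → Fin 4 → Fin 6 → ℤ) :
    (n : ℕ) → Fin 4 → List (Fin 4) → Fin 4 → List (ℤ × List (Fin 6))
  | 0, _, _, _ => [(1, [])]
  | n + 1, a, as, b =>
    (List.finRange (n + 1)).flatMap fun i : Fin (n + 1) =>
      snocWords (symbolWords d n a (as.eraseIdx i.val) b)
        (d ((as ++ [b]).getD (i.val + 1) 0) (as.getD i.val 0)
          - d ((a :: as).getD i.val 0) (as.getD i.val 0))

/-- The part of `Π̃_{n+2}` of a combination of words that ends in the letter `l`, stripped of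
this letter and before applying `Π̃_{n+1}`. -/
def projPart (n : ℕ) (l : Fin 6) (E : List (ℤ × List (Fin 6))) : List (ℤ × List (Fin 6)) :=
  E.flatMap fun p =>
    (bif (p.2.getD (n + 1) 0).val.beq l.val then [(p.1, p.2)] else []) ++
      (bif (p.2.getD 0 0).val.beq l.val then [(-p.1, p.2.tail)] else [])

/-- A test for the vanishing of `Π̃_n` on a combination of words. -/
def projVanishes : ℕ → List (ℤ × List (Fin 6)) → Bool
  | 0, _ => false
  | 1, E => (List.finRange 6).all fun l =>
      (E.map fun p : ℤ × List (Fin 6) =>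
        bif (p.2.getD 0 0).val.beq l.val then p.1 else 0).sum.natAbs.beq 0
  | n + 2, E => (List.finRange 6).all fun l => projVanishes (n + 1) (projPart n l E)


theorem evalWords_append (n : ℕ) (E E' : List (ℤ × List (Fin 6))) :
    evalWords L n (E ++ E') = evalWords L n E + evalWords L n E' := by
  simp [evalWords]

theorem evalWords_cons (n : ℕ) (p : ℤ × List (Fin 6)) (E : List (ℤ × List (Fin 6))) :
    evalWords L n (p :: E) = (p.1 : ℚ) • wordTensor L n p.2 + evalWords L n E := by
  simp [evalWords]

theorem evalWords_nil (n : ℕ) : evalWords L n [] = 0 := by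
  simp [evalWords]

theorem evalWords_flatMap {α : Type} (n : ℕ) (s : List α) (f : α → List (ℤ × List (Fin 6))) :
    evalWords L n (s.flatMap f) = (s.map fun a => evalWords L n (f a)).sum := by
  induction s with
  | nil => simp [evalWords_nil]
  | cons a s ih => simp [evalWords_append, ih]

theorem evalWords_scaleWords (n : ℕ) (c : ℤ) (E : List (ℤ × List (Fin 6))) :
    evalWords L n (scaleWords c E) = (c : ℚ) • evalWords L n E := by
  induction E with
  | nil => simp [scaleWords, evalWords_nil]
  | cons p E ih =>
    rw [scaleWords, List.map_cons, ← scaleWords, evalWords_cons, evalWords_cons, ih]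
    simp [mul_smul]

theorem snoc_wordTensor {n : ℕ} {w : List (Fin 6)} (hw : w.length = n) (l : Fin 6) :
    snoc (wordTensor L n w) (L l) = wordTensor L (n + 1) (w ++ [l]) := by
  rw [wordTensor, snoc_tprod, wordTensor]
  congr 1
  funext i
  refine Fin.lastCases ?_ (fun i => ?_) i
  · simp [← hw]
  · rw [Fin.snoc_castSucc, Fin.val_castSucc, List.getD_append _ _ _ _ (by omega)]

theorem evalWords_snocWords {n : ℕ} {E : List (ℤ × List (Fin 6))}
    (hE : ∀ p ∈ E, p.2.length = n) (v : Fin 6 → ℤ) :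
    evalWords L (n + 1) (snocWords E v) = snoc (evalWords L n E) (evalLetters L v) := by
  rw [snocWords, evalWords_flatMap, evalLetters, map_sum, Fin.sum_univ_def]
  congr 1
  refine List.map_congr_left fun l _ => ?_
  rw [map_smul]
  rcases eq_or_ne (v l) 0 with h | h
  · simp [h, evalWords_nil]
  · have h' : (v l).natAbs.beq 0 = false := by
      rw [← Bool.not_eq_true, Nat.beq_eq]; simpa using h
    rw [h', cond_false]
    induction E with
    | nil => simp [evalWords_nil]
    | cons p E ih =>
      rw [List.map_cons, evalWords_cons, ih fun q hq => hE q (List.mem_cons_of_mem _ hq),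
        evalWords_cons, map_add, map_smul, LinearMap.add_apply, LinearMap.smul_apply,
        snoc_wordTensor L (hE p List.mem_cons_self), smul_add, Int.cast_mul, mul_smul]

theorem length_of_mem_symbolWords (d : Fin 4 → Fin 4 → Fin 6 → ℤ) {n : ℕ} {a b : Fin 4}
    {as : List (Fin 4)} : ∀ p ∈ symbolWords d n a as b, p.2.length = n := by
  induction n generalizing as with
  | zero => simp [symbolWords]
  | succ n ih =>
    intro p hp
    simp only [symbolWords, snocWords, List.mem_flatMap] at hp
    obtain ⟨i, -, l, -, hp⟩ := hp
    cases h : (_ : ℕ).beq 0 <;> rw [h] at hp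
    · obtain ⟨q, hq, rfl⟩ := List.mem_map.mp hp
      simp [ih q hq]
    · simp at hp

/-- The symbol of an iterated integral on points whose differences are spelled in the letters. -/
theorem SIaux_eq_evalWords {d : Fin 4 → Fin 4 → Fin 6 → ℤ} {pt : Fin 4 → F}
    (hd : ∀ i j, cls (pt i - pt j) = evalLetters L (d i j)) (h0 : pt 0 = 0)
    {n : ℕ} (a : Fin 4) (as : List (Fin 4)) (b : Fin 4) (h : (as.map pt).length = n) :
    SIaux n (pt a) (as.map pt) (pt b) h = evalWords L n (symbolWords d n a as b) := by
  induction n generalizing as with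
  | zero =>
    rw [SIaux, symbolWords, evalWords_cons, evalWords_nil, Int.cast_one, one_smul, add_zero,
      wordTensor]
    congr 1
    funext i
    exact i.elim0
  | succ n ih =>
    rw [SIaux, symbolWords, evalWords_flatMap, Fin.sum_univ_def]
    congr 1
    refine List.map_congr_left fun i _ => ?_
    have hg : ∀ (s : List (Fin 4)) (k : ℕ), (s.map pt).getD k 0 = pt (s.getD k 0) := by
      intro s k
      rw [← h0, List.getD_map]
    have hsub : ∀ v w : Fin 6 → ℤ,
        evalLetters L (v - w) = evalLetters L v - evalLetters L w := by
      intro v w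
      simp [evalLetters, sub_smul, Finset.sum_sub_distrib]
    have hlen : ((as.eraseIdx i).map pt).length = n := by
      rw [List.length_map] at h ⊢
      rw [List.length_eraseIdx_of_lt (by omega)]
      omega
    rw [evalWords_snocWords L (length_of_mem_symbolWords d), ← ih _ hlen, tCoef_eq, hsub,
      ← hd, ← hd, ← hg, ← hg, ← hg]
    simp only [List.eraseIdx_map, List.map_append, List.map_cons, List.map_nil]

theorem Pit_wordTensor (n : ℕ) (w : List (Fin 6)) :
    Pit (n + 2) (wordTensor L (n + 2) w) =
      snoc (Pit (n + 1) (wordTensor L (n + 1) w)) (L (w.getD (n + 1) 0))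
        - snoc (Pit (n + 1) (wordTensor L (n + 1) w.tail)) (L (w.getD 0 0)) := by
  have htail : Fin.tail (fun i : Fin (n + 2) => L (w.getD i 0)) =
      fun i : Fin (n + 1) => L (w.tail.getD i 0) := by
    funext i
    cases w <;> simp [Fin.tail]
  rw [wordTensor, Pit_tprod, htail]
  rfl

theorem Pit_evalWords (n : ℕ) (E : List (ℤ × List (Fin 6))) :
    Pit (n + 2) (evalWords L (n + 2) E) =
      ∑ l, snoc (Pit (n + 1) (evalWords L (n + 1) (projPart n l E))) (L l) := by
  induction E with
  | nil => simp [projPart, evalWords_nil]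
  | cons p E ih =>
    have hsel : ∀ (k : Fin 6) (q : ℤ × List (Fin 6)),
        ∑ l : Fin 6, snoc (Pit (n + 1) (evalWords L (n + 1)
          (bif k.val.beq l.val then [q] else []))) (L l) =
        (q.1 : ℚ) • snoc (Pit (n + 1) (wordTensor L (n + 1) q.2)) (L k) := by
      intro k q
      rw [Finset.sum_eq_single k]
      · rw [Nat.beq_eq.mpr rfl, cond_true, evalWords_cons, evalWords_nil, add_zero, map_smul,
          map_smul, LinearMap.smul_apply]
      · intro l _ hl
        have h : k.val.beq l.val = false := by
          rw [← Bool.not_eq_true, Nat.beq_eq]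
          exact fun h => hl (Fin.ext h.symm)
        rw [h, cond_false, evalWords_nil, map_zero, map_zero, LinearMap.zero_apply]
      · simp
    have hpart : ∀ l, projPart n l (p :: E) =
        ((bif (p.2.getD (n + 1) 0).val.beq l.val then [(p.1, p.2)] else []) ++
          (bif (p.2.getD 0 0).val.beq l.val then [(-p.1, p.2.tail)] else [])) ++
            projPart n l E := fun l => List.flatMap_cons ..
    simp only [hpart, evalWords_append, map_add, LinearMap.add_apply, Finset.sum_add_distrib,
      hsel, ← ih]
    rw [evalWords_cons, map_add, map_smul, Pit_wordTensor, smul_sub, Int.cast_neg, neg_smul,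
      ← sub_eq_add_neg]

theorem evalWords_one (E : List (ℤ × List (Fin 6))) :
    evalWords L 1 E = ∑ l, (((E.map fun p : ℤ × List (Fin 6) =>
      bif (p.2.getD 0 0).val.beq l.val then p.1 else 0).sum : ℤ) : ℚ) • wordTensor L 1 [l] := by
  induction E with
  | nil => simp [evalWords_nil]
  | cons p E ih =>
    rw [evalWords_cons, ih]
    simp only [List.map_cons, List.sum_cons, Int.cast_add, add_smul, Finset.sum_add_distrib]
    congr 1
    rw [Finset.sum_eq_single (p.2.getD 0 0)]
    · rw [Nat.beq_eq.mpr rfl, cond_true, wordTensor, wordTensor]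
      congr 2
      funext i
      simp [Subsingleton.elim i 0]
    · intro l _ hl
      have h : (p.2.getD 0 0).val.beq l.val = false := by
        rw [← Bool.not_eq_true, Nat.beq_eq]
        exact fun h => hl (Fin.ext h.symm)
      rw [h, cond_false, Int.cast_zero, zero_smul]
    · simp

theorem Pit_evalWords_eq_zero {n : ℕ} {E : List (ℤ × List (Fin 6))}
    (h : projVanishes n E = true) : Pit n (evalWords L n E) = 0 := by
  induction n using Nat.strongRecOn generalizing E with
  | ind n ih =>
    match n, h, ih with
    | 0, h, _ => simp [projVanishes] at h
    | 1, h, _ =>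
      rw [Pit, LinearMap.id_apply, evalWords_one]
      refine Finset.sum_eq_zero fun l _ => ?_
      have hl := List.all_eq_true.mp h l (List.mem_finRange l)
      rw [Nat.beq_eq, Int.natAbs_eq_zero] at hl
      rw [hl, Int.cast_zero, zero_smul]
    | n + 2, h, ih =>
      rw [Pit_evalWords]
      refine Finset.sum_eq_zero fun l _ => ?_
      rw [ih (n + 1) (by omega) (List.all_eq_true.mp h l (List.mem_finRange l)), map_zero,
        LinearMap.zero_apply]

end Words

section DepthTwo

variable {F : Type} [Field F] (L : Fin 6 → VF F)

/-- The coordinates of the classes of the differences of the points `0, 1, u, v`, in terms of those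
of `u`, `v`, `1 - u`, `1 - v`, `u - v`. -/
def diffCoords (u v u' v' w : Fin 6 → ℤ) : Fin 4 → Fin 4 → Fin 6 → ℤ :=
  ![![0, 0, u, v], ![0, 0, u', v'], ![u, u', 0, w], ![v, v', w, 0]]

theorem cls_sub_eq_diffCoords {a b : F} {u v u' v' w : Fin 6 → ℤ}
    (hu : cls a = evalLetters L u) (hv : cls b = evalLetters L v)
    (hu' : cls (1 - a) = evalLetters L u') (hv' : cls (1 - b) = evalLetters L v')
    (hw : cls (a - b) = evalLetters L w) (i j : Fin 4) :
    cls ((![0, 1, a, b] : Fin 4 → F) i - (![0, 1, a, b] : Fin 4 → F) j) =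
      evalLetters L (diffCoords u v u' v' w i j) := by
  have hz : evalLetters L 0 = 0 := by simp [evalLetters]
  fin_cases i <;> fin_cases j <;>
    simp [diffCoords, hz, hu, hv, ← hu', ← hv', ← hw, cls_zero, cls_one, cls_neg, cls_sub_comm]

/-- The symbol of `I_{4,1}` as a combination of words. -/
def wordsI41 (u v u' v' w : Fin 6 → ℤ) : List (ℤ × List (Fin 6)) :=
  symbolWords (diffCoords u v u' v' w) 5 0 [2, 0, 0, 0, 3] 1

theorem SI41_eq {a b : F} {u v u' v' w : Fin 6 → ℤ}
    (hu : cls a = evalLetters L u) (hv : cls b = evalLetters L v)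
    (hu' : cls (1 - a) = evalLetters L u') (hv' : cls (1 - b) = evalLetters L v')
    (hw : cls (a - b) = evalLetters L w) :
    SI41 a b = evalWords L 5 (wordsI41 u v u' v' w) :=
  SIaux_eq_evalWords L (cls_sub_eq_diffCoords L hu hv hu' hv' hw) rfl 0 [2, 0, 0, 0, 3] 1 rfl

/-- The symbol of `Li₅` as a combination of words, in terms of the coordinates of the classes of
`u` and `1 - u` for `u` the inverse of the argument. -/
def wordsLi5 (u u' : Fin 6 → ℤ) : List (ℤ × List (Fin 6)) :=
  scaleWords (-1) (symbolWords (diffCoords u 0 u' 0 u) 5 0 [2, 0, 0, 0, 0] 1)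

theorem SLi5_eq {a : F} {u u' : Fin 6 → ℤ}
    (hu : cls a⁻¹ = evalLetters L u) (hu' : cls (1 - a⁻¹) = evalLetters L u') :
    SLi5 a = evalWords L 5 (wordsLi5 u u') := by
  have hz : evalLetters L 0 = 0 := by simp [evalLetters]
  have h : SIaux 5 0 [a⁻¹, 0, 0, 0, 0] 1 rfl =
      evalWords L 5 (symbolWords (diffCoords u 0 u' 0 u) 5 0 [2, 0, 0, 0, 0] 1) :=
    SIaux_eq_evalWords L (cls_sub_eq_diffCoords L (b := 0) (v := 0) (v' := 0) hu
      (by rw [hz, cls_zero]) hu' (by rw [hz, sub_zero, cls_one]) (by rw [sub_zero, hu]))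
      rfl 0 [2, 0, 0, 0, 0] 1 rfl
  rw [wordsLi5, evalWords_scaleWords, ← h, Int.cast_neg, Int.cast_one, neg_one_smul, SLi5]

end DepthTwo

section Inversion

/-- Twice the difference of both sides of the inversion identity, as a combination of words in
the letters `x, y, 1 - x, 1 - y, x - y, 1 - x * y`. -/
def inversionWords : List (ℤ × List (Fin 6)) :=
  wordsI41 ![1, 0, 0, 0, 0, 0] ![0, 1, 0, 0, 0, 0] ![0, 0, 1, 0, 0, 0] ![0, 0, 0, 1, 0, 0]
      ![0, 0, 0, 0, 1, 0] ++
    wordsI41 ![1, 0, 0, 0, 0, 0] ![0, -1, 0, 0, 0, 0] ![0, 0, 1, 0, 0, 0] ![0, -1, 0, 1, 0, 0]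
      ![0, -1, 0, 0, 0, 1] ++
    wordsI41 ![-1, 0, 0, 0, 0, 0] ![0, 1, 0, 0, 0, 0] ![-1, 0, 1, 0, 0, 0] ![0, 0, 0, 1, 0, 0]
      ![-1, 0, 0, 0, 0, 1] ++
    wordsI41 ![-1, 0, 0, 0, 0, 0] ![0, -1, 0, 0, 0, 0] ![-1, 0, 1, 0, 0, 0] ![0, -1, 0, 1, 0, 0]
      ![-1, -1, 0, 0, 1, 0] ++
    scaleWords 4 (wordsLi5 ![1, -1, 0, 0, 0, 0] ![0, -1, 0, 0, 1, 0]) ++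
    scaleWords 4 (wordsLi5 ![-1, -1, 0, 0, 0, 0] ![-1, -1, 0, 0, 0, 1]) ++
    scaleWords 2 (wordsLi5 ![-1, 0, 0, 0, 0, 0] ![-1, 0, 1, 0, 0, 0]) ++
    scaleWords 2 (wordsLi5 ![0, -1, 0, 0, 0, 0] ![0, -1, 0, 1, 0, 0])

theorem projVanishes_inversionWords : projVanishes 5 inversionWords = true := by
  decide +kernel

/-- The inversion identity at any point of a field where all letters are nonzero. -/
theorem Pit_I41p_add_I41p_inv {F : Type} [Field F] {x y : F} (hx : x ≠ 0) (hy : y ≠ 0)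
    (hx' : 1 - x ≠ 0) (hy' : 1 - y ≠ 0) (hxy : x - y ≠ 0) (hxy' : 1 - x * y ≠ 0) :
    Pit 5 (I41p x y + I41p x⁻¹ y) =
      Pit 5 ((-2 : ℚ) • SLi5 (y / x) - (2 : ℚ) • SLi5 (x * y) - SLi5 x - SLi5 y) := by
  let L : Fin 6 → VF F := ![cls x, cls y, cls (1 - x), cls (1 - y), cls (x - y), cls (1 - x * y)]
  have hL : ∀ v, evalLetters L v = (v 0 : ℚ) • cls x + (v 1 : ℚ) • cls y
      + (v 2 : ℚ) • cls (1 - x) + (v 3 : ℚ) • cls (1 - y) + (v 4 : ℚ) • cls (x - y)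
      + (v 5 : ℚ) • cls (1 - x * y) := fun v => by
    simp [evalLetters, Fin.sum_univ_succ, L, add_assoc]
  have hxi : cls (1 - x⁻¹) = cls (1 - x) - cls x := by
    rw [← cls_div hx' hx, ← cls_neg]
    congr 1
    field_simp
    ring
  have hyi : cls (1 - y⁻¹) = cls (1 - y) - cls y := by
    rw [← cls_div hy' hy, ← cls_neg]
    congr 1
    field_simp
    ring
  have h₁ : cls (x - y⁻¹) = cls (1 - x * y) - cls y := by
    rw [← cls_div hxy' hy, ← cls_neg]
    congr 1
    field_simp
    ring
  have h₂ : cls (x⁻¹ - y) = cls (1 - x * y) - cls x := by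
    rw [← cls_div hxy' hx]
    congr 1
    field_simp
  have h₃ : cls (x⁻¹ - y⁻¹) = cls (x - y) - (cls x + cls y) := by
    rw [← cls_mul hx hy, ← cls_div hxy (mul_ne_zero hx hy), ← cls_neg]
    congr 1
    field_simp
    ring
  have h₄ : cls (1 - (y / x)⁻¹) = cls (x - y) - cls y := by
    rw [← cls_div hxy hy, ← cls_neg]
    congr 1
    field_simp
    ring
  have h₅ : cls (1 - (x * y)⁻¹) = cls (1 - x * y) - (cls x + cls y) := by
    rw [← cls_mul hx hy, ← cls_div hxy' (mul_ne_zero hx hy), ← cls_neg]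
    congr 1
    field_simp
    ring
  have e := Pit_evalWords_eq_zero L projVanishes_inversionWords
  simp only [inversionWords, evalWords_append, evalWords_scaleWords] at e
  rw [← SI41_eq L (a := x) (b := y), ← SI41_eq L (a := x) (b := y⁻¹),
    ← SI41_eq L (a := x⁻¹) (b := y), ← SI41_eq L (a := x⁻¹) (b := y⁻¹),
    ← SLi5_eq L (a := y / x), ← SLi5_eq L (a := x * y), ← SLi5_eq L (a := x),
    ← SLi5_eq L (a := y)] at e
  · have comb : ∀ A B C D P Q R S : TP F 5,
        ((2 : ℚ)⁻¹ • (A + B) + (2 : ℚ)⁻¹ • (C + D)) - ((-2 : ℚ) • P - (2 : ℚ) • Q - R - S) =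
          (2 : ℚ)⁻¹ • (A + B + C + D + ((4 : ℤ) : ℚ) • P + ((4 : ℤ) : ℚ) • Q
            + ((2 : ℤ) : ℚ) • R + ((2 : ℤ) : ℚ) • S) := by
      intros
      push_cast
      module
    rw [← sub_eq_zero, ← map_sub, I41p, I41p, comb, map_smul, e, smul_zero]
  all_goals
    rw [hL]
    try simp only [hxi, hyi, h₁, h₂, h₃, h₄, h₅, cls_inv, cls_div hy hx, cls_mul hx hy]
    simp
  all_goals abel

theorem algebraMap_K2_ne_zero {p : MvPolynomial (Fin 2) ℚ} (s : Fin 2 → ℚ)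
    (h : MvPolynomial.eval s p ≠ 0) : algebraMap (MvPolynomial (Fin 2) ℚ) K2 p ≠ 0 := by
  rw [Ne, IsFractionRing.to_map_eq_zero_iff]
  rintro rfl
  exact h (map_zero _)

end Inversion

end GrassPoly

/-- inversion identity for `I⁺_{4,1}` in the first argument. -/
theorem i41p_inversion :
    Pit 5 (I41p xx yy + I41p xx⁻¹ yy) =
      Pit 5 ((-2 : ℚ) • SLi5 (yy / xx) - (2 : ℚ) • SLi5 (xx * yy)
        - SLi5 xx - SLi5 yy) := by
  have h (p : MvPolynomial (Fin 2) ℚ) := algebraMap_K2_ne_zero (p := p) ![2, 3]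
  refine Pit_I41p_add_I41p_inv ?_ ?_ ?_ ?_ ?_ ?_
  · exact h (.X 0) (by simp)
  · exact h (.X 1) (by simp)
  · simpa [xx] using h (1 - .X 0) (by norm_num)
  · simpa [yy] using h (1 - .X 1) (by norm_num)
  · simpa [xx, yy] using h (.X 0 - .X 1) (by norm_num)
  · simpa [xx, yy] using h (1 - .X 0 * .X 1) (by norm_num)
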